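/- For any order α ∈ [0,∞] and any probability measures P and Q on a measurable space, D_α(P‖Q) ≥ 0. For α > 0, D_α(P‖Q) = 0 if and only if P = Q. For α = 0, D_0(P‖Q) = 0 if and only if Q is absolutely continuous with respect to P. -/

import Mathlib

open MeasureTheory Real Filter Set
open scoped ENNReal NNReal Topology Classical

/-- The Hellinger integral `∫ p^α q^(1-α) dμ`, computed with the dominating
measure `μ = P + Q` (the value does not depend on the choice of dominating
measure). The `ℝ≥0∞`-valued `rpow` automatically implements the conventions
`0/0 = 0` and `x/0 = ∞` for `x > 0` when `α > 1`. -/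
noncomputable def hellingerInt {X : Type*} [MeasurableSpace X]
    (α : ℝ) (P Q : Measure X) : ℝ≥0∞ :=
  ∫⁻ x, P.rnDeriv (P + Q) x ^ α * Q.rnDeriv (P + Q) x ^ (1 - α) ∂(P + Q)

/-- Rényi divergence of a simple order `α ∈ (0,1) ∪ (1,∞)`:
`D_α(P‖Q) = (α-1)⁻¹ log ∫ p^α q^(1-α) dμ`. -/
noncomputable def renyiSimple {X : Type*} [MeasurableSpace X]
    (α : ℝ) (P Q : Measure X) : EReal :=
  (((α - 1)⁻¹ : ℝ) : EReal) * ENNReal.log (hellingerInt α P Q)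

/-- Rényi divergence of any order `α ∈ [0,∞]`.  The extended orders `0`, `1`, `∞`
are defined as the limits of the simple orders (the limits exist by monotonicity
in the order, so they coincide with the `limsup`s used here). -/
noncomputable def renyiDiv {X : Type*} [MeasurableSpace X]
    (α : ℝ≥0∞) (P Q : Measure X) : EReal :=
  if α = 0 then Filter.limsup (fun a : ℝ => renyiSimple a P Q) (nhdsWithin (0:ℝ) (Set.Ioi 0))
  else if α = 1 then Filter.limsup (fun a : ℝ => renyiSimple a P Q) (nhdsWithin (1:ℝ) (Set.Iio 1))
  else if α = ∞ then Filter.limsup (fun a : ℝ => renyiSimple a P Q) Filter.atTop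
  else renyiSimple α.toReal P Q

/-- Kullback-Leibler divergence `D(P‖Q) = ∫ p log (p/q) dμ`, with the conventions
`0 log (0/q) = 0` and `p log (p/0) = ∞` for `p > 0`; in particular `D(P‖Q) = ∞`
whenever `P` is not absolutely continuous w.r.t. `Q`, or the integral diverges. -/
noncomputable def klDiv {X : Type*} [MeasurableSpace X] (P Q : Measure X) : EReal :=
  if P ≪ Q ∧ Integrable (llr P Q) P then ((∫ x, llr P Q x ∂P : ℝ) : EReal) else ⊤

lemma aux_amgm_le {x y : ℝ≥0∞} {t : ℝ} (ht0 : 0 < t) (ht1 : t < 1) (hx : x ≠ ∞) (hy : y ≠ ∞) :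
    x ^ t * y ^ (1 - t) ≤ ENNReal.ofReal t * x + ENNReal.ofReal (1 - t) * y := by
  lift x to ℝ≥0 using hx
  lift y to ℝ≥0 using hy
  lift t to ℝ≥0 using ht0.le
  have ht1' : t ≤ 1 := by exact_mod_cast ht1.le
  have h := NNReal.geom_mean_le_arith_mean2_weighted t (1 - t) x y (by simp [ht1'])
  rw [← NNReal.coe_one, ← NNReal.coe_sub ht1', ENNReal.ofReal_coe_nnreal, ENNReal.ofReal_coe_nnreal,
    ← ENNReal.coe_rpow_of_nonneg _ t.coe_nonneg, ← ENNReal.coe_rpow_of_nonneg _ (1 - t).coe_nonneg]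
  exact_mod_cast h

lemma aux_amgm_eq {x y : ℝ≥0∞} {t : ℝ} (ht0 : 0 < t) (ht1 : t < 1) (hx : x ≠ ∞) (hy : y ≠ ∞)
    (h : x ^ t * y ^ (1 - t) = ENNReal.ofReal t * x + ENNReal.ofReal (1 - t) * y) : x = y := by
  have h' := congrArg ENNReal.toReal h
  rw [ENNReal.toReal_add (by finiteness) (by finiteness)] at h'
  simp only [ENNReal.toReal_mul, ← ENNReal.toReal_rpow, ENNReal.toReal_ofReal ht0.le,
    ENNReal.toReal_ofReal (sub_nonneg.2 ht1.le)] at h'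
  have := (Real.geom_mean_eq_arith_mean_weighted_iff_of_pos Finset.univ ![t, 1 - t]
    ![x.toReal, y.toReal] (by simp [Fin.forall_fin_two, ht0, ht1]) (by simp)
    (by simp [Fin.forall_fin_two])).1 (by simpa using h')
  have h2 := this 0 (by simp) 1 (by simp)
  exact (ENNReal.toReal_eq_toReal_iff' hx hy).1 (by simpa using h2)

section
variable {X : Type*} [MeasurableSpace X] (P Q : Measure X)
    [IsProbabilityMeasure P] [IsProbabilityMeasure Q]

lemma aux_acP : P ≪ P + Q := Measure.AbsolutelyContinuous.rfl.add_right Q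

lemma aux_acQ : Q ≪ P + Q := by
  rw [add_comm]; exact Measure.AbsolutelyContinuous.rfl.add_right P

lemma aux_intP : ∫⁻ x, P.rnDeriv (P + Q) x ∂(P + Q) = 1 := by
  rw [Measure.lintegral_rnDeriv (aux_acP P Q)]; simp

lemma aux_intQ : ∫⁻ x, Q.rnDeriv (P + Q) x ∂(P + Q) = 1 := by
  rw [Measure.lintegral_rnDeriv (aux_acQ P Q)]; simp

lemma aux_eq_of_ae (h : P.rnDeriv (P + Q) =ᵐ[P + Q] Q.rnDeriv (P + Q)) : P = Q := by
  rw [← Measure.withDensity_rnDeriv_eq P (P + Q) (aux_acP P Q), withDensity_congr_ae h,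
    Measure.withDensity_rnDeriv_eq Q (P + Q) (aux_acQ P Q)]

lemma aux_mix (t : ℝ) (f : X → ℝ≥0∞) (hf : Measurable f) :
    ∫⁻ x, (ENNReal.ofReal t * f x + ENNReal.ofReal (1 - t) * Q.rnDeriv (P + Q) x) ∂(P + Q)
      = ENNReal.ofReal t * ∫⁻ x, f x ∂(P + Q) + ENNReal.ofReal (1 - t) := by
  rw [lintegral_add_left (by fun_prop), lintegral_const_mul _ hf,
    lintegral_const_mul _ (by fun_prop), aux_intQ, mul_one]

lemma aux_ofReal {t : ℝ} (ht0 : 0 < t) (ht1 : t < 1) :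
    ENNReal.ofReal t + ENNReal.ofReal (1 - t) = 1 := by
  rw [← ENNReal.ofReal_add ht0.le (by linarith)]; simp

lemma aux_H_lt {t : ℝ} (ht0 : 0 < t) (ht1 : t < 1) :
    hellingerInt t P Q ≤ 1 ∧ (hellingerInt t P Q = 1 → P = Q) := by
  have hle : ∀ᵐ x ∂(P + Q), P.rnDeriv (P + Q) x ^ t * Q.rnDeriv (P + Q) x ^ (1 - t) ≤
      ENNReal.ofReal t * P.rnDeriv (P + Q) x + ENNReal.ofReal (1 - t) * Q.rnDeriv (P + Q) x := by
    filter_upwards [P.rnDeriv_ne_top (P + Q), Q.rnDeriv_ne_top (P + Q)] with x hp hq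
    exact aux_amgm_le ht0 ht1 hp hq
  have hint := aux_mix P Q t (P.rnDeriv (P + Q)) (by fun_prop)
  rw [aux_intP, mul_one, aux_ofReal ht0 ht1] at hint
  refine ⟨(lintegral_mono_ae hle).trans hint.le, fun h => aux_eq_of_ae P Q ?_⟩
  unfold hellingerInt at h
  have := ae_eq_of_ae_le_of_lintegral_le hle (by rw [h]; simp) (by fun_prop) (by rw [h, hint])
  filter_upwards [this, P.rnDeriv_ne_top (P + Q), Q.rnDeriv_ne_top (P + Q)] with x h hp hq
  exact aux_amgm_eq ht0 ht1 hp hq h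

lemma aux_pt {a : ℝ} (ha : 1 < a) {p q : ℝ≥0∞} (hp : p ≠ ∞) (hq : q ≠ ∞)
    (h : p ^ a * q ^ (1 - a) ≠ ∞) : p = (p ^ a * q ^ (1 - a)) ^ a⁻¹ * q ^ (1 - a⁻¹) := by
  have ha0 : 0 < a := by linarith
  have hi : 0 < a⁻¹ := by positivity
  by_cases hq0 : q = 0
  · subst hq0
    have h0 : (1 - a) < 0 := by linarith
    have hp0 : p = 0 := by
      by_contra hp0
      apply h
      rw [ENNReal.zero_rpow_of_neg h0]
      refine ENNReal.mul_top ?_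
      simp [hp0, hp]
    simp [hp0, ha0, hi]
  · rw [ENNReal.mul_rpow_of_nonneg _ _ hi.le, ← ENNReal.rpow_mul, mul_inv_cancel₀ ha0.ne',
      ENNReal.rpow_one, ← ENNReal.rpow_mul, mul_assoc, ← ENNReal.rpow_add _ _ hq0 hq]
    have : (1 - a) * a⁻¹ + (1 - a⁻¹) = 0 := by field_simp; ring
    simp [this]

lemma aux_H_gt {a : ℝ} (ha : 1 < a) :
    1 ≤ hellingerInt a P Q ∧ (hellingerInt a P Q = 1 → P = Q) := by
  have ha0 : 0 < a := by linarith
  have hi : 0 < a⁻¹ := by positivity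
  have hi1 : a⁻¹ < 1 := inv_lt_one_of_one_lt₀ ha
  set h : X → ℝ≥0∞ := fun x => P.rnDeriv (P + Q) x ^ a * Q.rnDeriv (P + Q) x ^ (1 - a) with hh
  have hm : Measurable h := by fun_prop
  have hH : hellingerInt a P Q = ∫⁻ x, h x ∂(P + Q) := rfl
  have hle : ∀ᵐ x ∂(P + Q), P.rnDeriv (P + Q) x ≤
      ENNReal.ofReal a⁻¹ * h x + ENNReal.ofReal (1 - a⁻¹) * Q.rnDeriv (P + Q) x := by
    filter_upwards [P.rnDeriv_ne_top (P + Q), Q.rnDeriv_ne_top (P + Q)] with x hp hq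
    by_cases hx : h x = ∞
    · rw [hx, ENNReal.mul_top (by simpa using ha0)]; simp
    · calc _ = h x ^ a⁻¹ * Q.rnDeriv (P + Q) x ^ (1 - a⁻¹) := aux_pt ha hp hq hx
        _ ≤ _ := aux_amgm_le hi hi1 hx hq
  have hint := aux_mix P Q a⁻¹ h hm
  rw [← hH] at hint
  have h1 := aux_ofReal hi hi1
  constructor
  · by_contra! hlt
    have h2 := lintegral_mono_ae hle
    rw [aux_intP, hint] at h2
    refine absurd h2 (not_le.2 ?_)
    calc ENNReal.ofReal a⁻¹ * hellingerInt a P Q + ENNReal.ofReal (1 - a⁻¹)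
        < ENNReal.ofReal a⁻¹ * 1 + ENNReal.ofReal (1 - a⁻¹) := by
          refine ENNReal.add_lt_add_right (by simp) ?_
          exact ENNReal.mul_lt_mul_right (by simpa using ha0) (by simp) hlt
      _ = 1 := by rw [mul_one, h1]
  · intro h2
    rw [h2, mul_one, h1] at hint
    refine aux_eq_of_ae P Q ?_
    have := ae_eq_of_ae_le_of_lintegral_le hle (by rw [aux_intP]; simp) (by fun_prop)
      (by rw [aux_intP, hint])
    filter_upwards [this, P.rnDeriv_ne_top (P + Q), Q.rnDeriv_ne_top (P + Q)] with x he hp hq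
    have hx : h x ≠ ∞ := by
      intro hx
      rw [hx, ENNReal.mul_top (by simpa using ha0)] at he
      simp [hp] at he
    have hpt := aux_pt ha hp hq hx
    have heq : h x = Q.rnDeriv (P + Q) x :=
      aux_amgm_eq hi hi1 hx hq (by rw [← he]; exact hpt.symm)
    change _ = h x ^ a⁻¹ * _ at hpt
    rw [heq, ← ENNReal.rpow_add_of_nonneg _ _ hi.le (by linarith)] at hpt
    simpa using hpt

lemma aux_holder {a t : ℝ} (ha : 0 ≤ a) (ht0 : 0 ≤ t) (ht1 : t ≤ 1) :
    hellingerInt (t * a + (1 - t)) P Q ≤ hellingerInt a P Q ^ t := by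
  have := ENNReal.lintegral_mul_norm_pow_le (μ := P + Q)
    (f := fun x => P.rnDeriv (P + Q) x ^ a * Q.rnDeriv (P + Q) x ^ (1 - a))
    (g := P.rnDeriv (P + Q)) (by fun_prop) (by fun_prop) ht0 (sub_nonneg.2 ht1) (by ring)
  rw [aux_intP, ENNReal.one_rpow, mul_one] at this
  refine le_trans (le_of_eq ?_) this
  unfold hellingerInt
  congr 1
  ext x
  rw [ENNReal.rpow_add_of_nonneg _ _ (by positivity) (by linarith), ENNReal.mul_rpow_of_nonneg _ _ ht0,
    ← ENNReal.rpow_mul, ← ENNReal.rpow_mul, mul_comm a t]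
  have : 1 - (t * a + (1 - t)) = (1 - a) * t := by ring
  rw [this]; ring

lemma aux_mono_lt {a b : ℝ} (ha : 0 < a) (hab : a ≤ b) (hb : b < 1) :
    renyiSimple a P Q ≤ renyiSimple b P Q := by
  have h1 : a - 1 < 0 := by linarith
  have h2 : b - 1 < 0 := by linarith
  have h := aux_holder P Q (a := a) (t := (b - 1) / (a - 1)) ha.le
    (div_nonneg_of_nonpos h2.le h1.le) ((div_le_one_of_neg h1).2 (by linarith))
  have hb' : (b - 1) / (a - 1) * a + (1 - (b - 1) / (a - 1)) = b := by
    have := h1.ne; field_simp; ring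
  rw [hb'] at h
  have h3 := ENNReal.log_le_log h
  rw [ENNReal.log_rpow] at h3
  have h4 : (((b - 1)⁻¹ : ℝ) : EReal) ≤ 0 := by exact_mod_cast (inv_lt_zero.2 h2).le
  have h5 := EReal.mul_le_mul_of_nonpos_right h3 h4
  unfold renyiSimple
  rw [mul_comm] at h5
  rw [mul_comm _ (ENNReal.log (hellingerInt b P Q))]
  refine le_trans (le_of_eq ?_) h5
  rw [← mul_assoc, ← EReal.coe_mul]
  congr 2
  have := h1.ne; have := h2.ne; field_simp

lemma aux_mono_gt {a b : ℝ} (ha : 1 < a) (hab : a ≤ b) :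
    renyiSimple a P Q ≤ renyiSimple b P Q := by
  have h1 : 0 < a - 1 := by linarith
  have h2 : 0 < b - 1 := by linarith
  have h := aux_holder P Q (a := b) (t := (a - 1) / (b - 1)) (by linarith)
    (by positivity) ((div_le_one h2).2 (by linarith))
  have hb' : (a - 1) / (b - 1) * b + (1 - (a - 1) / (b - 1)) = a := by
    have := h2.ne'; field_simp; ring
  rw [hb'] at h
  have h3 := ENNReal.log_le_log h
  rw [ENNReal.log_rpow] at h3
  have h4 : 0 ≤ (((a - 1)⁻¹ : ℝ) : EReal) := by exact_mod_cast (inv_pos.2 h1).le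
  have h5 := mul_le_mul_of_nonneg_left h3 h4
  unfold renyiSimple
  refine h5.trans (le_of_eq ?_)
  rw [← mul_assoc, ← EReal.coe_mul]
  congr 2
  have := h1.ne'; have := h2.ne'; field_simp

lemma aux_simple_lt {a : ℝ} (ha0 : 0 < a) (ha1 : a < 1) :
    0 ≤ renyiSimple a P Q ∧ (renyiSimple a P Q = 0 → P = Q) := by
  obtain ⟨h1, h2⟩ := aux_H_lt P Q ha0 ha1
  have h3 : (a - 1)⁻¹ < 0 := inv_lt_zero.2 (by linarith)
  constructor
  · have h4 : (((a - 1)⁻¹ : ℝ) : EReal) ≤ 0 := by exact_mod_cast h3.le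
    have := EReal.mul_le_mul_of_nonpos_right (ENNReal.log_le_zero_iff.2 h1) h4
    rw [zero_mul, mul_comm] at this
    exact this
  · intro h
    rcases mul_eq_zero.1 h with h | h
    · exact absurd (by exact_mod_cast h) h3.ne
    · exact h2 (ENNReal.log_eq_one_iff.1 h)

lemma aux_simple_gt {a : ℝ} (ha : 1 < a) :
    0 ≤ renyiSimple a P Q ∧ (renyiSimple a P Q = 0 → P = Q) := by
  obtain ⟨h1, h2⟩ := aux_H_gt P Q ha
  have h3 : 0 < (a - 1)⁻¹ := inv_pos.2 (by linarith)
  constructor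
  · exact mul_nonneg (by exact_mod_cast h3.le) (ENNReal.zero_le_log_iff.2 h1)
  · intro h
    rcases mul_eq_zero.1 h with h | h
    · exact absurd (by exact_mod_cast h) h3.ne'
    · exact h2 (ENNReal.log_eq_one_iff.1 h)

lemma aux_self {a : ℝ} (ha : 0 < a) : renyiSimple a P P = 0 := by
  have : hellingerInt a P P = 1 := by
    rw [← aux_intP P P]
    unfold hellingerInt
    refine lintegral_congr_ae ?_
    filter_upwards [P.rnDeriv_ne_top (P + P)] with x hx
    by_cases h0 : P.rnDeriv (P + P) x = 0
    · simp [h0, ha]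
    · rw [← ENNReal.rpow_add _ _ h0 hx]; simp
  simp [renyiSimple, this]

lemma aux_zero_iff :
    limsup (fun a : ℝ => renyiSimple a P Q) (𝓝[>] 0) = 0 ↔ Q ≪ P := by
  set S : Set X := {x | P.rnDeriv (P + Q) x ≠ 0} with hS
  have hSm : MeasurableSet S := (measurableSet_singleton (0:ℝ≥0∞)).compl.preimage (by fun_prop)
  have hQS : ∫⁻ x, S.indicator (Q.rnDeriv (P + Q)) x ∂(P + Q) = Q S := by
    rw [lintegral_indicator hSm, Measure.setLIntegral_rnDeriv (aux_acQ P Q)]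
  have hH : Tendsto (fun a : ℝ => hellingerInt a P Q) (𝓝[>] 0) (𝓝 (Q S)) := by
    rw [← hQS]
    refine tendsto_lintegral_filter_of_dominated_convergence
      (fun x => P.rnDeriv (P + Q) x + Q.rnDeriv (P + Q) x) ?_ ?_ ?_ ?_
    · exact Eventually.of_forall fun a => by fun_prop
    · filter_upwards [Ioo_mem_nhdsGT (zero_lt_one (α := ℝ))] with a ha
      filter_upwards [P.rnDeriv_ne_top (P + Q), Q.rnDeriv_ne_top (P + Q)] with x hp hq
      refine (aux_amgm_le ha.1 ha.2 hp hq).trans ?_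
      gcongr
      · exact mul_le_of_le_one_left' (by simpa using ha.2.le)
      · exact mul_le_of_le_one_left' (by simpa using ha.1.le)
    · rw [lintegral_add_left (by fun_prop), aux_intP, aux_intQ]; simp
    · filter_upwards [P.rnDeriv_ne_top (P + Q), Q.rnDeriv_ne_top (P + Q)] with x hp hq
      by_cases hx : P.rnDeriv (P + Q) x = 0
      · have : S.indicator (Q.rnDeriv (P + Q)) x = 0 := by simp [hS, hx]
        rw [this]
        refine tendsto_const_nhds.congr' ?_
        filter_upwards [self_mem_nhdsWithin] with a ha
        simp [hx, show 0 < a from ha]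
      · have : S.indicator (Q.rnDeriv (P + Q)) x = Q.rnDeriv (P + Q) x := by simp [hS, hx]
        rw [this]
        generalize P.rnDeriv (P + Q) x = p at hp hx
        generalize Q.rnDeriv (P + Q) x = q at hq
        lift p to ℝ≥0 using hp
        lift q to ℝ≥0 using hq
        have hx' : p ≠ 0 := by exact_mod_cast hx
        have hid : Tendsto (fun a : ℝ => a) (𝓝[>] 0) (𝓝 0) := nhdsWithin_le_nhds
        have t1 : Tendsto (fun a : ℝ => p ^ a) (𝓝[>] 0) (𝓝 (p ^ (0:ℝ))) :=
          tendsto_const_nhds.nnrpow hid (Or.inl hx')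
        have t2 : Tendsto (fun a : ℝ => q ^ (1 - a)) (𝓝[>] 0) (𝓝 (q ^ (1 - 0:ℝ))) :=
          tendsto_const_nhds.nnrpow (tendsto_const_nhds.sub hid) (Or.inr (by norm_num))
        have t3 := ENNReal.tendsto_coe.2 (t1.mul t2)
        simp only [NNReal.rpow_zero, sub_zero, NNReal.rpow_one, one_mul] at t3
        refine t3.congr' ?_
        filter_upwards [Ioo_mem_nhdsGT (zero_lt_one (α := ℝ))] with a ha
        rw [ENNReal.coe_mul, ENNReal.coe_rpow_of_nonneg _ ha.1.le,
          ENNReal.coe_rpow_of_nonneg _ (sub_nonneg.2 ha.2.le)]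
  have hne : (((((0:ℝ) - 1)⁻¹ : ℝ)) : EReal) ≠ 0 := by
    rw [Ne, EReal.coe_eq_zero]; norm_num
  have hD : Tendsto (fun a : ℝ => renyiSimple a P Q) (𝓝[>] 0)
      (𝓝 ((((0:ℝ) - 1)⁻¹ : ℝ) * ENNReal.log (Q S))) := by
    have hc : Tendsto (fun a : ℝ => (((a - 1)⁻¹ : ℝ) : EReal)) (𝓝[>] 0)
        (𝓝 ((((0:ℝ) - 1)⁻¹ : ℝ) : EReal)) := by
      refine (continuous_coe_real_ereal.tendsto _).comp (Tendsto.mono_left ?_ nhdsWithin_le_nhds)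
      exact (ContinuousAt.inv₀ (by fun_prop) (by norm_num) : ContinuousAt (fun a : ℝ => (a - 1)⁻¹) 0)
    have hl := (ENNReal.continuous_log.tendsto _).comp hH
    exact EReal.Tendsto.mul hc hl (Or.inl hne) (Or.inl hne) (Or.inl (EReal.coe_ne_bot _))
      (Or.inl (EReal.coe_ne_top _))
  rw [hD.limsup_eq, mul_eq_zero, or_iff_right hne, ENNReal.log_eq_one_iff,
    ← prob_compl_eq_zero_iff hSm]
  constructor
  · intro h
    refine Measure.AbsolutelyContinuous.mk fun A hA hPA => ?_
    rw [← Measure.setLIntegral_rnDeriv (aux_acP P Q), lintegral_eq_zero_iff (by fun_prop)] at hPA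
    have h2 := (aux_acQ P Q).restrict A |>.ae_le hPA
    replace h2 := (ae_restrict_iff' hA).1 h2
    have h3 : ∀ᵐ x ∂Q, x ∈ S := h
    have h4 : ∀ᵐ x ∂Q, x ∉ A := by
      filter_upwards [h2, h3] with x hx hx' hxA
      exact hx' (hx hxA)
    simpa [ae_iff] using h4
  · intro h
    apply h
    rw [← Measure.setLIntegral_rnDeriv (aux_acP P Q), lintegral_eq_zero_iff (by fun_prop)]
    refine (ae_restrict_iff' hSm.compl).2 ?_
    refine Eventually.of_forall fun x hx => ?_
    simpa [hS] using hx
end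

/-- **Positivity.** For any order `α ∈ [0,∞]`, `D_α(P‖Q) ≥ 0`.  For `α > 0`,
`D_α(P‖Q) = 0` iff `P = Q`; for `α = 0`, `D_0(P‖Q) = 0` iff `Q ≪ P`. -/
theorem renyiDiv_nonneg_and_eq_zero_iff
    {X : Type*} [MeasurableSpace X] (P Q : Measure X)
    [IsProbabilityMeasure P] [IsProbabilityMeasure Q] (α : ℝ≥0∞) :
    0 ≤ renyiDiv α P Q ∧
    (0 < α → (renyiDiv α P Q = 0 ↔ P = Q)) ∧
    (renyiDiv 0 P Q = 0 ↔ Q ≪ P) := by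
  have h0 : renyiDiv 0 P Q = limsup (fun a : ℝ => renyiSimple a P Q) (𝓝[>] 0) := by
    simp [renyiDiv]
  have h1 : renyiDiv 1 P Q = limsup (fun a : ℝ => renyiSimple a P Q) (𝓝[<] 1) := by
    simp [renyiDiv]
  have hinf : renyiDiv ∞ P Q = limsup (fun a : ℝ => renyiSimple a P Q) atTop := by
    simp [renyiDiv]
  have e1 : ∀ᶠ a in 𝓝[<] (1:ℝ), a ∈ Ioo (1/2 : ℝ) 1 := Ioo_mem_nhdsLT (by norm_num)
  have einf : ∀ᶠ a in (atTop : Filter ℝ), 2 ≤ a := eventually_ge_atTop 2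
  have l1 : renyiSimple (1/2) P Q ≤ renyiDiv 1 P Q := by
    rw [h1]
    refine le_limsup_of_frequently_le' (Eventually.frequently ?_)
    filter_upwards [e1] with a ha using aux_mono_lt P Q (by norm_num) ha.1.le ha.2
  have linf : renyiSimple 2 P Q ≤ renyiDiv ∞ P Q := by
    rw [hinf]
    refine le_limsup_of_frequently_le' (Eventually.frequently ?_)
    filter_upwards [einf] with a ha using aux_mono_gt P Q (by norm_num) ha
  have s1 := aux_simple_lt P Q (a := 1/2) (by norm_num) (by norm_num)
  have s2 := aux_simple_gt P Q (a := 2) (by norm_num)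
  refine ⟨?_, ?_, by rw [h0]; exact aux_zero_iff P Q⟩
  · by_cases a0 : α = 0
    · rw [a0, h0]
      refine le_limsup_of_frequently_le' (Eventually.frequently ?_)
      filter_upwards [Ioo_mem_nhdsGT (zero_lt_one (α := ℝ))] with a ha
      exact (aux_simple_lt P Q ha.1 ha.2).1
    by_cases a1 : α = 1
    · rw [a1]; exact s1.1.trans l1
    by_cases ai : α = ∞
    · rw [ai]; exact s2.1.trans linf
    simp only [renyiDiv, a0, a1, ai, if_false]
    have hpos := ENNReal.toReal_pos a0 ai
    have hne : α.toReal ≠ 1 := by simpa [ENNReal.toReal_eq_one_iff] using a1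
    rcases lt_or_gt_of_ne hne with h | h
    · exact (aux_simple_lt P Q hpos h).1
    · exact (aux_simple_gt P Q h).1
  · intro hα
    have a0 : α ≠ 0 := hα.ne'
    constructor
    · by_cases a1 : α = 1
      · rw [a1]; intro h; exact s1.2 (le_antisymm (l1.trans h.le) s1.1)
      by_cases ai : α = ∞
      · rw [ai]; intro h; exact s2.2 (le_antisymm (linf.trans h.le) s2.1)
      simp only [renyiDiv, a0, a1, ai, if_false]
      have hpos := ENNReal.toReal_pos a0 ai
      have hne : α.toReal ≠ 1 := by simpa [ENNReal.toReal_eq_one_iff] using a1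
      rcases lt_or_gt_of_ne hne with h | h
      · exact (aux_simple_lt P Q hpos h).2
      · exact (aux_simple_gt P Q h).2
    · intro hPQ
      subst hPQ
      by_cases a1 : α = 1
      · rw [a1, h1]
        rw [limsup_congr (v := fun _ => (0 : EReal))]
        · simp
        · filter_upwards [e1] with a ha using aux_self P (by linarith [ha.1])
      by_cases ai : α = ∞
      · rw [ai, hinf]
        rw [limsup_congr (v := fun _ => (0 : EReal))]
        · simp
        · filter_upwards [einf] with a ha using aux_self P (by linarith)
      simp only [renyiDiv, a0, a1, ai, if_false]
      exact aux_self P (ENNReal.toReal_pos a0 ai)
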